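/- The assignment I ↦ Î, where Î^γ := I^γ_{σ→τ} for every path γ : [σ,τ] → B, is a bijection from the set of parallel transports along paths in a bundle (E,π,B) onto the set of topological parallel transports in (E,π,B). -/

import Mathlib

open Set Function

/-- A transport along paths in the bundle `(E, π, B)`: to every path `γ : J → B` (a function
`ℝ → B` together with an interval `J ⊆ ℝ` as its domain) and all `s, t ∈ J` it assigns a map
of the fibre over `γ s` into the fibre over `γ t`, satisfying the composition and identity
axioms.  (The data is encoded as a total map `E → E`; only its values on the fibre over `γ s`
are constrained.) -/
structure PathTransport {E B : Type*} (π : E → B) where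
  T : Set ℝ → (ℝ → B) → ℝ → ℝ → E → E
  maps_fibre : ∀ (J : Set ℝ), J.OrdConnected → ∀ (γ : ℝ → B) (s t : ℝ), s ∈ J → t ∈ J →
    ∀ e : E, π e = γ s → π (T J γ s t e) = γ t
  comp : ∀ (J : Set ℝ), J.OrdConnected → ∀ (γ : ℝ → B) (r s t : ℝ), r ∈ J → s ∈ J → t ∈ J →
    ∀ e : E, π e = γ r → T J γ s t (T J γ r s e) = T J γ r t e
  id_eq : ∀ (J : Set ℝ), J.OrdConnected → ∀ (γ : ℝ → B) (s : ℝ), s ∈ J →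
    ∀ e : E, π e = γ s → T J γ s s e = e


/-- The restriction condition: for every path `γ : J → B`, every subinterval `J' ⊆ J` and all
`s, t ∈ J'`, one has `I^{γ|J'}_{s→t} = I^γ_{s→t}` (on the fibre over `γ s`). -/
def PathTransport.Restricts {E B : Type*} {π : E → B} (I : PathTransport π) : Prop :=
  ∀ (J J' : Set ℝ), J.OrdConnected → J'.OrdConnected → J' ⊆ J →
    ∀ (γ : ℝ → B) (s t : ℝ), s ∈ J' → t ∈ J' → ∀ e : E, π e = γ s →
      I.T J' γ s t e = I.T J γ s t e

/-- The reparametrization condition: for every path `γ : J → B`, every strictly monotone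
bijection `χ : J'' → J` and all `s, t ∈ J''`, one has `I^{γ∘χ}_{s→t} = I^γ_{χ(s)→χ(t)}`. -/
def PathTransport.Reparams {E B : Type*} {π : E → B} (I : PathTransport π) : Prop :=
  ∀ (J J'' : Set ℝ), J.OrdConnected → J''.OrdConnected →
    ∀ (γ : ℝ → B) (χ : ℝ → ℝ), Set.BijOn χ J'' J →
      (StrictMonoOn χ J'' ∨ StrictAntiOn χ J'') →
      ∀ (s t : ℝ), s ∈ J'' → t ∈ J'' → ∀ e : E, π e = γ (χ s) →
        I.T J'' (γ ∘ χ) s t e = I.T J γ (χ s) (χ t) e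

/-- A topological parallel transport in the bundle `(E, π, B)`: to every path
`γ : [σ,τ] → B` it assigns a map `P̂^γ` of the fibre over `γ σ` into the fibre over `γ τ`,
invariant under increasing reparametrizations, compatible with inverse paths and products of
canonical paths, and equal to the identity on paths `[r,r] → {x}`.  (The data is encoded as
a total map `E → E`; only its values on the fibre over `γ σ` are constrained.) -/
structure ParTransport {E B : Type*} (π : E → B) where
  P : ℝ → ℝ → (ℝ → B) → E → E
  maps_fibre : ∀ (σ τ : ℝ), σ ≤ τ → ∀ (γ : ℝ → B) (e : E), π e = γ σ →
    π (P σ τ γ e) = γ τ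
  reparam : ∀ (σ τ σ' τ' : ℝ), σ ≤ τ → σ' ≤ τ' → ∀ (γ : ℝ → B) (χ : ℝ → ℝ),
    StrictMonoOn χ (Set.Icc σ' τ') → Set.BijOn χ (Set.Icc σ' τ') (Set.Icc σ τ) →
    ∀ e : E, π e = γ σ → P σ' τ' (γ ∘ χ) e = P σ τ γ e
  inv_left : ∀ (γ : ℝ → B) (e : E), π e = γ 0 →
    P 0 1 (fun u => γ (1 - u)) (P 0 1 γ e) = e
  inv_right : ∀ (γ : ℝ → B) (e : E), π e = γ 1 →
    P 0 1 γ (P 0 1 (fun u => γ (1 - u)) e) = e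
  prod : ∀ (γ₁ γ₂ : ℝ → B), γ₁ 1 = γ₂ 0 → ∀ e : E, π e = γ₁ 0 →
    P 0 1 (fun t => if t ≤ 1 / 2 then γ₁ (2 * t) else γ₂ (2 * t - 1)) e
      = P 0 1 γ₂ (P 0 1 γ₁ e)
  id_eq : ∀ (r : ℝ) (γ : ℝ → B) (e : E), π e = γ r → P r r γ e = e

/-- `HatEq I Q` says that the topological parallel transport `Q` is the image `Î` of the
transport along paths `I` under the assignment `I ↦ Î`, `Î^γ := I^γ_{σ→τ}` for
`γ : [σ,τ] → B`. -/
def HatEq {E B : Type*} {π : E → B} (I : PathTransport π) (Q : ParTransport π) : Prop :=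
  ∀ (σ τ : ℝ), σ ≤ τ → ∀ (γ : ℝ → B) (e : E), π e = γ σ →
    I.T (Set.Icc σ τ) γ σ τ e = Q.P σ τ γ e

/-- Equality of two transports along paths (as fibre maps, for all paths on intervals). -/
def AgreeTP {E B : Type*} {π : E → B} (I I' : PathTransport π) : Prop :=
  ∀ (J : Set ℝ), J.OrdConnected → ∀ (γ : ℝ → B) (s t : ℝ), s ∈ J → t ∈ J →
    ∀ e : E, π e = γ s → I.T J γ s t e = I'.T J γ s t e

theorem PathTransport.congr_of_eqOn {E B : Type*} {π : E → B} {I : PathTransport π}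
    (hI : I.Reparams) {J : Set ℝ} (hJ : J.OrdConnected) {γ γ' : ℝ → B} (h : EqOn γ γ' J)
    {s t : ℝ} (hs : s ∈ J) (ht : t ∈ J) {e : E} (he : π e = γ s) :
    I.T J γ s t e = I.T J γ' s t e := by
  classical
  set χ : ℝ → ℝ := fun u => if u ∈ J then u else s with hχ
  have hid : EqOn χ id J := fun u hu => if_pos hu
  have hbij : BijOn χ J J := (bijOn_id J).congr hid.symm
  have hmono : StrictMonoOn χ J := fun u hu v hv huv => by
    simpa [hid hu, hid hv] using huv
  have hcomp : γ ∘ χ = γ' ∘ χ := by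
    funext u
    refine h ?_
    by_cases hu : u ∈ J <;> simp [hχ, hu, hs]
  have hχs : χ s = s := hid hs
  have hχt : χ t = t := hid ht
  have h₁ := hI J J hJ hJ γ χ hbij (.inl hmono) s t hs ht e (by rw [hχs, he])
  have h₂ := hI J J hJ hJ γ' χ hbij (.inl hmono) s t hs ht e (by rw [hχs, he, h hs])
  rw [hχs, hχt] at h₁ h₂
  rw [← h₁, ← h₂, hcomp]

theorem bijOn_affine {a b c d : ℝ} (m k : ℝ) (hm : 0 < m) (hc : m * a + k = c)
    (hd : m * b + k = d) : BijOn (fun u : ℝ => m * u + k) (Icc a b) (Icc c d) := by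
  subst hc hd
  refine ⟨fun u hu => ⟨?_, ?_⟩, fun u _ v _ h => ?_, fun v hv => ⟨(v - k) / m, ⟨?_, ?_⟩, ?_⟩⟩
  · have := mul_le_mul_of_nonneg_left hu.1 hm.le
    simpa using this
  · have := mul_le_mul_of_nonneg_left hu.2 hm.le
    simpa using this
  · simpa [hm.ne'] using h
  · rw [le_div_iff₀ hm]; linarith [hv.1]
  · rw [div_le_iff₀ hm]; linarith [hv.2]
  · simp only
    field_simp
    ring

theorem bijOn_reflect (a b : ℝ) : BijOn (fun u : ℝ => a + b - u) (Icc a b) (Icc a b) := by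
  refine ⟨fun u hu => ⟨by linarith [hu.2], by linarith [hu.1]⟩, fun u _ v _ h => ?_,
    fun v hv => ⟨a + b - v, ⟨by linarith [hv.2], by linarith [hv.1]⟩, by simp⟩⟩
  simpa using h

theorem strictMono_affine {m : ℝ} (k : ℝ) (hm : 0 < m) :
    StrictMono (fun u : ℝ => m * u + k) := fun u v h => by
  have := mul_lt_mul_of_pos_left h hm
  simpa using this

theorem strictAnti_reflect (c : ℝ) : StrictAnti (fun u : ℝ => c - u) := fun u v h => by
  simpa using h

theorem StrictMonoOn.map_endpoints {χ : ℝ → ℝ} {a b c d : ℝ} (hab : a ≤ b) (hcd : c ≤ d)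
    (hχ : StrictMonoOn χ (Icc a b)) (hb : BijOn χ (Icc a b) (Icc c d)) :
    χ a = c ∧ χ b = d := by
  constructor
  · obtain ⟨u, hu, huc⟩ := hb.surjOn (left_mem_Icc.2 hcd)
    exact le_antisymm (huc ▸ hχ.monotoneOn (left_mem_Icc.2 hab) hu hu.1)
      (hb.mapsTo (left_mem_Icc.2 hab)).1
  · obtain ⟨u, hu, hud⟩ := hb.surjOn (right_mem_Icc.2 hcd)
    exact le_antisymm (hb.mapsTo (right_mem_Icc.2 hab)).2
      (hud ▸ hχ.monotoneOn hu (right_mem_Icc.2 hab) hu.2)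

theorem PathTransport.reflect {E B : Type*} {π : E → B} {I : PathTransport π}
    (hI : I.Reparams) {a b : ℝ} (hab : a ≤ b) (γ : ℝ → B) {e : E} (he : π e = γ b) :
    I.T (Icc a b) (fun u => γ (a + b - u)) a b e = I.T (Icc a b) γ b a e := by
  have h := hI (Icc a b) (Icc a b) ordConnected_Icc ordConnected_Icc γ (fun u => a + b - u)
    (bijOn_reflect a b) (.inr ((strictAnti_reflect _).strictAntiOn _)) a b
    (left_mem_Icc.2 hab) (right_mem_Icc.2 hab) e (by simpa using he)
  simpa [Function.comp_def] using h

theorem PathTransport.canonical_prod {E B : Type*} {π : E → B} {I : PathTransport π}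
    (hR : I.Restricts) (hI : I.Reparams) (γ₁ γ₂ : ℝ → B) (h : γ₁ 1 = γ₂ 0) {e : E}
    (he : π e = γ₁ 0) :
    I.T (Icc 0 1) (fun t => if t ≤ 1 / 2 then γ₁ (2 * t) else γ₂ (2 * t - 1)) 0 1 e
      = I.T (Icc 0 1) γ₂ 0 1 (I.T (Icc 0 1) γ₁ 0 1 e) := by
  set γ : ℝ → B := fun t => if t ≤ 1 / 2 then γ₁ (2 * t) else γ₂ (2 * t - 1) with hγ
  have hγ0 : γ 0 = γ₁ 0 := by simp [hγ]
  have hγh : γ (1 / 2) = γ₁ 1 := by simp [hγ]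
  have first : ∀ e, π e = γ₁ 0 →
      I.T (Icc 0 1) γ 0 (1 / 2) e = I.T (Icc 0 1) γ₁ 0 1 e := by
    intro e he
    have h0 : (0 : ℝ) ∈ Icc (0 : ℝ) (1 / 2) := by norm_num
    have h1 : (1 / 2 : ℝ) ∈ Icc (0 : ℝ) (1 / 2) := by norm_num
    rw [← hR (Icc 0 1) (Icc 0 (1 / 2)) ordConnected_Icc ordConnected_Icc
      (Icc_subset_Icc_right (by norm_num)) γ 0 (1 / 2) h0 h1 e (he.trans hγ0.symm)]
    have hre := hI (Icc 0 1) (Icc 0 (1 / 2)) ordConnected_Icc ordConnected_Icc γ₁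
      (fun u => 2 * u + 0) (bijOn_affine 2 0 (by norm_num) (by norm_num) (by norm_num))
      (.inl ((strictMono_affine 0 (by norm_num)).strictMonoOn _)) 0 (1 / 2) h0 h1 e
      (by simpa using he)
    rw [PathTransport.congr_of_eqOn hI ordConnected_Icc (γ' := γ₁ ∘ fun u => 2 * u + 0) ?_ h0 h1
      (he.trans hγ0.symm), hre]
    · norm_num
    · intro u hu
      simp [hγ, show u ≤ 2⁻¹ by linarith [hu.2]]
  have second : ∀ e, π e = γ₂ 0 →
      I.T (Icc 0 1) γ (1 / 2) 1 e = I.T (Icc 0 1) γ₂ 0 1 e := by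
    intro e he
    have he' : π e = γ (1 / 2) := he.trans (h.symm.trans hγh.symm)
    have h0 : (1 / 2 : ℝ) ∈ Icc (1 / 2 : ℝ) 1 := by norm_num
    have h1 : (1 : ℝ) ∈ Icc (1 / 2 : ℝ) 1 := by norm_num
    rw [← hR (Icc 0 1) (Icc (1 / 2) 1) ordConnected_Icc ordConnected_Icc
      (Icc_subset_Icc_left (by norm_num)) γ (1 / 2) 1 h0 h1 e he']
    have hre := hI (Icc 0 1) (Icc (1 / 2) 1) ordConnected_Icc ordConnected_Icc γ₂
      (fun u => 2 * u + -1) (bijOn_affine 2 (-1) (by norm_num) (by norm_num) (by norm_num))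
      (.inl ((strictMono_affine (-1) (by norm_num)).strictMonoOn _)) (1 / 2) 1 h0 h1 e
      (by simpa using he)
    rw [PathTransport.congr_of_eqOn hI ordConnected_Icc (γ' := γ₂ ∘ fun u => 2 * u + -1) ?_ h0 h1
      he', hre]
    · norm_num
    · intro u hu
      rcases eq_or_lt_of_le hu.1 with rfl | hlt
      · rw [hγh, h]
        norm_num
      · simp [hγ, show ¬ u ≤ 2⁻¹ by linarith, sub_eq_add_neg]
  have m0 : (0 : ℝ) ∈ Icc (0 : ℝ) 1 := by norm_num
  have mh : (1 / 2 : ℝ) ∈ Icc (0 : ℝ) 1 := by norm_num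
  have m1 : (1 : ℝ) ∈ Icc (0 : ℝ) 1 := by norm_num
  rw [← I.comp (Icc 0 1) ordConnected_Icc γ 0 (1 / 2) 1 m0 mh m1 e (he.trans hγ0.symm),
    first e he, second]
  rw [← h]
  exact I.maps_fibre _ ordConnected_Icc γ₁ 0 1 m0 m1 e he

/-- The topological parallel transport `Î` induced by a parallel transport along paths `I`. -/
def PathTransport.hat {E B : Type*} {π : E → B} (I : PathTransport π) (hR : I.Restricts)
    (hI : I.Reparams) : ParTransport π where
  P σ τ γ := I.T (Icc σ τ) γ σ τ
  maps_fibre σ τ h γ e he :=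
    I.maps_fibre _ ordConnected_Icc γ σ τ (left_mem_Icc.2 h) (right_mem_Icc.2 h) e he
  reparam σ τ σ' τ' h h' γ χ hχ hb e he := by
    obtain ⟨hσ, hτ⟩ := hχ.map_endpoints h' h hb
    have := hI _ _ ordConnected_Icc ordConnected_Icc γ χ hb (.inl hχ) σ' τ'
      (left_mem_Icc.2 h') (right_mem_Icc.2 h') e (by rw [hσ, he])
    rwa [hσ, hτ] at this
  inv_left γ e he := by
    have m0 : (0 : ℝ) ∈ Icc (0 : ℝ) 1 := by norm_num
    have m1 : (1 : ℝ) ∈ Icc (0 : ℝ) 1 := by norm_num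
    have := PathTransport.reflect hI zero_le_one γ
      (I.maps_fibre _ ordConnected_Icc γ 0 1 m0 m1 e he)
    simp only [zero_add] at this
    rw [this, I.comp _ ordConnected_Icc γ 0 1 0 m0 m1 m0 e he,
      I.id_eq _ ordConnected_Icc γ 0 m0 e he]
  inv_right γ e he := by
    have m0 : (0 : ℝ) ∈ Icc (0 : ℝ) 1 := by norm_num
    have m1 : (1 : ℝ) ∈ Icc (0 : ℝ) 1 := by norm_num
    have := PathTransport.reflect hI zero_le_one γ he
    simp only [zero_add] at this
    rw [this, I.comp _ ordConnected_Icc γ 1 0 1 m1 m0 m1 e he,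
      I.id_eq _ ordConnected_Icc γ 1 m1 e he]
  prod γ₁ γ₂ h e he := PathTransport.canonical_prod hR hI γ₁ γ₂ h he
  id_eq r γ e he := I.id_eq _ ordConnected_Icc γ r (left_mem_Icc.2 le_rfl) e he

theorem PathTransport.agree_of_hat_eq {E B : Type*} {π : E → B} {I I' : PathTransport π}
    (hR : I.Restricts) (hI : I.Reparams) (hR' : I'.Restricts) (hI' : I'.Reparams)
    (h : ∀ (σ τ : ℝ), σ ≤ τ → ∀ (γ : ℝ → B) (e : E), π e = γ σ →
      I.T (Icc σ τ) γ σ τ e = I'.T (Icc σ τ) γ σ τ e) : AgreeTP I I' := by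
  intro J hJ γ s t hs ht e he
  rcases le_total s t with hst | hst
  · have hsub : Icc s t ⊆ J := hJ.out hs ht
    have ms := left_mem_Icc.2 hst
    have mt := right_mem_Icc.2 hst
    rw [← hR J _ hJ ordConnected_Icc hsub γ s t ms mt e he,
      ← hR' J _ hJ ordConnected_Icc hsub γ s t ms mt e he, h s t hst γ e he]
  · have hsub : Icc t s ⊆ J := hJ.out ht hs
    have mt := left_mem_Icc.2 hst
    have ms := right_mem_Icc.2 hst
    rw [← hR J _ hJ ordConnected_Icc hsub γ s t ms mt e he,
      ← hR' J _ hJ ordConnected_Icc hsub γ s t ms mt e he,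
      ← PathTransport.reflect hI hst γ he, ← PathTransport.reflect hI' hst γ he]
    exact h t s hst _ e (by simpa using he)

namespace ParTransport

variable {E B : Type*} {π : E → B} (Q : ParTransport π)

theorem const_eq (b : B) {e : E} (he : π e = b) : Q.P 0 1 (fun _ => b) e = e := by
  have hprod := Q.prod (fun _ => b) (fun _ => b) rfl e he
  simp only [ite_self] at hprod
  rw [hprod]
  exact Q.inv_left (fun _ => b) e he

/-- Transport along the part of `γ` from `s` to `t`, parametrized affinely by `[0,1]`. -/
def segment (γ : ℝ → B) (s t : ℝ) : E → E :=
  Q.P 0 1 fun u => γ (s + u * (t - s))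

theorem segment_maps (γ : ℝ → B) (s t : ℝ) {e : E} (he : π e = γ s) :
    π (Q.segment γ s t e) = γ t := by
  have := Q.maps_fibre 0 1 zero_le_one (fun u => γ (s + u * (t - s))) e (by simpa using he)
  simpa [segment] using this

theorem segment_self (γ : ℝ → B) (s : ℝ) {e : E} (he : π e = γ s) :
    Q.segment γ s s e = e := by
  simpa [segment] using Q.const_eq (γ s) he

theorem segment_inv (γ : ℝ → B) (s t : ℝ) {e : E} (he : π e = γ s) :
    Q.segment γ t s (Q.segment γ s t e) = e := by
  have h := Q.inv_left (fun u => γ (s + u * (t - s))) e (by simpa using he)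
  have hfun : (fun u : ℝ => γ (s + (1 - u) * (t - s))) = fun u => γ (t + u * (s - t)) := by
    funext u
    congr 1
    ring
  rwa [hfun] at h

theorem segment_eq (γ : ℝ → B) {σ τ : ℝ} (h : σ ≤ τ) {e : E} (he : π e = γ σ) :
    Q.segment γ σ τ e = Q.P σ τ γ e := by
  rcases h.eq_or_lt with rfl | hlt
  · rw [Q.segment_self γ σ he, Q.id_eq σ γ e he]
  · have hpos := sub_pos.2 hlt
    rw [← Q.reparam σ τ 0 1 h zero_le_one γ (fun u => (τ - σ) * u + σ)
      ((strictMono_affine _ hpos).strictMonoOn _)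
      (bijOn_affine _ _ hpos (by ring) (by ring)) e he]
    have hfun : (γ ∘ fun u => (τ - σ) * u + σ) = fun u => γ (σ + u * (τ - σ)) := by
      funext u
      simp only [Function.comp_apply]
      congr 1
      ring
    rw [hfun, segment]

theorem segment_comp_of_between (γ : ℝ → B) {r s t a : ℝ} (ha₀ : 0 < a) (ha₁ : a < 1)
    (hs : s = r + a * (t - r)) {e : E} (he : π e = γ r) :
    Q.segment γ s t (Q.segment γ r s e) = Q.segment γ r t e := by
  have hb : 0 < 1 - a := sub_pos.2 ha₁
  set χ : ℝ → ℝ := fun u => if u ≤ 1 / 2 then 2 * a * u else a + (2 * u - 1) * (1 - a) with hχ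
  have hlow : ∀ u, u ≤ 1 / 2 → χ u = 2 * a * u := fun u hu => if_pos hu
  have hhigh : ∀ u, 1 / 2 < u → χ u = a + (2 * u - 1) * (1 - a) :=
    fun u hu => if_neg (not_le.2 hu)
  have hmono : StrictMono χ := by
    intro u v huv
    rcases le_or_gt u (1 / 2) with hu | hu <;> rcases le_or_gt v (1 / 2) with hv | hv
    · rw [hlow u hu, hlow v hv]; nlinarith
    · rw [hlow u hu, hhigh v hv]; nlinarith
    · linarith
    · rw [hhigh u hu, hhigh v hv]; nlinarith
  have h0 : χ 0 = 0 := by rw [hlow 0 (by norm_num)]; ring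
  have h1 : χ 1 = 1 := by rw [hhigh 1 (by norm_num)]; ring
  have hbij : BijOn χ (Icc 0 1) (Icc 0 1) := by
    refine ⟨fun u hu => ⟨h0 ▸ hmono.monotone hu.1, h1 ▸ hmono.monotone hu.2⟩,
      hmono.injective.injOn, fun v hv => ?_⟩
    rcases le_or_gt v a with hva | hva
    · have hle : v / (2 * a) ≤ 1 / 2 := by
        rw [div_le_iff₀ (by positivity)]; linarith
      refine ⟨v / (2 * a), ⟨div_nonneg hv.1 (by positivity), by linarith⟩, ?_⟩
      rw [hlow _ hle]
      field_simp
    · have hpos : 0 < (v - a) / (1 - a) := div_pos (sub_pos.2 hva) hb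
      have hle : (v - a) / (1 - a) ≤ 1 := by
        rw [div_le_one hb]; linarith [hv.2]
      refine ⟨((v - a) / (1 - a) + 1) / 2, ⟨by linarith, by linarith⟩, ?_⟩
      rw [hhigh _ (by linarith)]
      field_simp
      ring
  have hprod := Q.prod (fun u => γ (r + u * (s - r))) (fun u => γ (s + u * (t - s)))
    (by simp) e (by simpa using he)
  have hre := Q.reparam 0 1 0 1 zero_le_one zero_le_one (fun u => γ (r + u * (t - r))) χ
    (hmono.strictMonoOn _) hbij e (by simpa using he)
  rw [segment, segment, segment, ← hprod, ← hre]
  congr 1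
  funext u
  simp only [Function.comp_apply, hχ]
  split_ifs
  · congr 1
    rw [hs]; ring
  · congr 1
    rw [hs]; ring

theorem segment_comp_of_mem_uIcc (γ : ℝ → B) {r s t : ℝ} (hs : s ∈ uIcc r t) {e : E}
    (he : π e = γ r) : Q.segment γ s t (Q.segment γ r s e) = Q.segment γ r t e := by
  by_cases hrs : s = r
  · rw [hrs, Q.segment_self γ r he]
  by_cases hst : s = t
  · rw [hst, Q.segment_self γ t (Q.segment_maps γ r t he)]
  rcases mem_uIcc.1 hs with ⟨h₁, h₂⟩ | ⟨h₁, h₂⟩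
  · have l₁ := lt_of_le_of_ne h₁ (Ne.symm hrs)
    have l₂ := lt_of_le_of_ne h₂ hst
    have hpos : 0 < t - r := by linarith
    refine Q.segment_comp_of_between γ (a := (s - r) / (t - r)) (div_pos (by linarith) hpos)
      ((div_lt_one hpos).2 (by linarith)) ?_ he
    field_simp
    ring
  · have l₁ := lt_of_le_of_ne h₁ (Ne.symm hst)
    have l₂ := lt_of_le_of_ne h₂ hrs
    have hpos : 0 < r - t := by linarith
    refine Q.segment_comp_of_between γ (a := (r - s) / (r - t)) (div_pos (by linarith) hpos)
      ((div_lt_one hpos).2 (by linarith)) ?_ he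
    field_simp
    ring

theorem segment_comp (γ : ℝ → B) (r s t : ℝ) {e : E} (he : π e = γ r) :
    Q.segment γ s t (Q.segment γ r s e) = Q.segment γ r t e := by
  have hcases : s ∈ uIcc r t ∨ t ∈ uIcc r s ∨ r ∈ uIcc s t := by
    simp only [mem_uIcc]
    grind
  rcases hcases with h | h | h
  · exact Q.segment_comp_of_mem_uIcc γ h he
  · rw [← Q.segment_comp_of_mem_uIcc γ h he, Q.segment_inv γ t s (Q.segment_maps γ r t he)]
  · rw [← Q.segment_comp_of_mem_uIcc γ h (Q.segment_maps γ r s he), Q.segment_inv γ r s he]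

theorem segment_reparam {J J' : Set ℝ} (hJ : J.OrdConnected) (hJ' : J'.OrdConnected)
    (γ : ℝ → B) {χ : ℝ → ℝ} (hb : BijOn χ J' J)
    (hχ : StrictMonoOn χ J' ∨ StrictAntiOn χ J') {s t : ℝ} (hs : s ∈ J') (ht : t ∈ J')
    {e : E} (he : π e = γ (χ s)) :
    Q.segment (γ ∘ χ) s t e = Q.segment γ (χ s) (χ t) e := by
  by_cases hst : s = t
  · subst hst
    rw [Q.segment_self (γ ∘ χ) s he, Q.segment_self γ (χ s) he]
  have hne : χ t - χ s ≠ 0 := fun h => hst (hb.injOn hs ht (by linarith))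
  have hmem : ∀ {a b : ℝ} {K : Set ℝ}, K.OrdConnected → a ∈ K → b ∈ K → ∀ {u : ℝ},
      u ∈ Icc (0 : ℝ) 1 → a + u * (b - a) ∈ K := by
    intro a b K hK ha hb u hu
    refine hK.uIcc_subset ha hb (mem_uIcc.2 ?_)
    rcases le_total a b with h | h
    · exact .inl ⟨by nlinarith [hu.1], by nlinarith [hu.2]⟩
    · exact .inr ⟨by nlinarith [hu.2], by nlinarith [hu.1]⟩
  set ψ : ℝ → ℝ := fun u => (χ (s + u * (t - s)) - χ s) / (χ t - χ s) with hψ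
  have hψ_eq : ∀ u, χ s + ψ u * (χ t - χ s) = χ (s + u * (t - s)) := by
    intro u
    simp only [hψ]
    field_simp
    ring
  have h0 : ψ 0 = 0 := by simp [hψ]
  have h1 : ψ 1 = 1 := by simp [hψ, hne]
  have hmono : StrictMonoOn ψ (Icc 0 1) := by
    intro u hu v hv huv
    have mu := hmem hJ' hs ht hu
    have mv := hmem hJ' hs ht hv
    simp only [hψ]
    rcases lt_or_gt_of_ne hst with h | h <;> rcases hχ with hχ | hχ
    · have h2 := hχ hs ht h
      have h3 := hχ mu mv (by nlinarith)
      exact div_lt_div_of_pos_right (by linarith) (by linarith)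
    · have h2 := hχ hs ht h
      have h3 := hχ mu mv (by nlinarith)
      exact div_lt_div_of_neg_of_lt (by linarith) (by linarith)
    · have h2 := hχ ht hs h
      have h3 := hχ mv mu (by nlinarith)
      exact div_lt_div_of_neg_of_lt (by linarith) (by linarith)
    · have h2 := hχ ht hs h
      have h3 := hχ mv mu (by nlinarith)
      exact div_lt_div_of_pos_right (by linarith) (by linarith)
  have m0 : (0 : ℝ) ∈ Icc (0 : ℝ) 1 := by norm_num
  have m1 : (1 : ℝ) ∈ Icc (0 : ℝ) 1 := by norm_num
  have hbij : BijOn ψ (Icc 0 1) (Icc 0 1) := by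
    refine ⟨fun u hu => ⟨h0 ▸ hmono.monotoneOn m0 hu hu.1, h1 ▸ hmono.monotoneOn hu m1 hu.2⟩,
      hmono.injOn, fun v hv => ?_⟩
    obtain ⟨w, hw, hwv⟩ := hb.surjOn (hmem hJ (hb.mapsTo hs) (hb.mapsTo ht) hv)
    have hts : t - s ≠ 0 := sub_ne_zero.2 (Ne.symm hst)
    have hwu : s + (w - s) / (t - s) * (t - s) = w := by
      field_simp
      ring
    have hv_eq : ψ ((w - s) / (t - s)) = v := by
      simp only [hψ]
      rw [hwu, hwv]
      field_simp
      ring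
    refine ⟨(w - s) / (t - s), ?_, hv_eq⟩
    have hw_mem : w ∈ uIcc s t := by
      have hv_mem : χ w ∈ uIcc (χ s) (χ t) := by
        rw [hwv]
        exact hmem ordConnected_uIcc left_mem_uIcc right_mem_uIcc hv
      rw [mem_uIcc] at hv_mem ⊢
      rcases hχ with hχ | hχ
      · rwa [hχ.le_iff_le hs hw, hχ.le_iff_le hw ht, hχ.le_iff_le ht hw,
          hχ.le_iff_le hw hs] at hv_mem
      · rw [hχ.le_iff_ge hs hw, hχ.le_iff_ge hw ht, hχ.le_iff_ge ht hw,
          hχ.le_iff_ge hw hs] at hv_mem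
        tauto
    rcases mem_uIcc.1 hw_mem with ⟨h₁, h₂⟩ | ⟨h₁, h₂⟩
    · have hpos : 0 < t - s := lt_of_le_of_ne (by linarith) hts.symm
      exact ⟨div_nonneg (by linarith) hpos.le, (div_le_one hpos).2 (by linarith)⟩
    · have hneg : t - s < 0 := lt_of_le_of_ne (by linarith) hts
      exact ⟨div_nonneg_of_nonpos (by linarith) hneg.le,
        (div_le_one_of_neg hneg).2 (by linarith)⟩
  have hre := Q.reparam 0 1 0 1 zero_le_one zero_le_one
    (fun u => γ (χ s + u * (χ t - χ s))) ψ hmono hbij e (by simpa using he)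
  have hfun : ((fun u => γ (χ s + u * (χ t - χ s))) ∘ ψ) =
      fun u => (γ ∘ χ) (s + u * (t - s)) := by
    funext u
    simp only [Function.comp_apply, hψ_eq]
  rw [hfun] at hre
  exact hre

/-- The transport along paths induced by a topological parallel transport. -/
def toPathTransport : PathTransport π where
  T _ γ s t := Q.segment γ s t
  maps_fibre _ _ γ s t _ _ _ he := Q.segment_maps γ s t he
  comp _ _ γ r s t _ _ _ _ he := Q.segment_comp γ r s t he
  id_eq _ _ γ s _ _ he := Q.segment_self γ s he

end ParTransport

/-- The assignment `I ↦ Î`, `Î^γ := I^γ_{σ→τ}` for `γ : [σ,τ] → B`, is a bijection from the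
set of parallel transports along paths (transports along paths satisfying the restriction and
reparametrization conditions) onto the set of topological parallel transports:  (1) the image
`Î` of any parallel transport along paths is a topological parallel transport; (2) the
assignment is injective; (3) it is surjective onto the set of topological parallel
transports. -/
theorem stmt10 {E B : Type*} [TopologicalSpace E] [TopologicalSpace B]
    (π : E → B) (hπcont : Continuous π) (hπsurj : Function.Surjective π) :
    (∀ I : PathTransport π, I.Restricts → I.Reparams → ∃ Q : ParTransport π, HatEq I Q) ∧
    (∀ I I' : PathTransport π, I.Restricts → I.Reparams → I'.Restricts → I'.Reparams →
      (∀ (σ τ : ℝ), σ ≤ τ → ∀ (γ : ℝ → B) (e : E), π e = γ σ →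
        I.T (Set.Icc σ τ) γ σ τ e = I'.T (Set.Icc σ τ) γ σ τ e) →
      AgreeTP I I') ∧
    (∀ Q : ParTransport π, ∃ I : PathTransport π,
      I.Restricts ∧ I.Reparams ∧ HatEq I Q) := by
  refine ⟨fun I hR hI => ⟨I.hat hR hI, fun _ _ _ _ _ _ => rfl⟩,
    fun I I' hR hI hR' hI' h => PathTransport.agree_of_hat_eq hR hI hR' hI' h,
    fun Q => ⟨Q.toPathTransport, fun _ _ _ _ _ _ _ _ _ _ _ _ => rfl, ?_, ?_⟩⟩
  · intro J J'' hJ hJ'' γ χ hb hχ s t hs ht e he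
    exact Q.segment_reparam hJ hJ'' γ hb hχ hs ht he
  · intro σ τ h γ e he
    exact Q.segment_eq γ h he
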